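/- arXiv:2211.12367 — 2 statements merged into one kernel-verified Lean document; each statement's English description precedes it below -/
import Mathlib

section
/- If t is a positive integer with t ≡ 3 (mod 6), then there does not exist a cyclic skew frame starter of type 5^t in Z_{5t}. -/
/-- The family `f`, indexed by `Fin m ⊕ Fin m`, hits each element of `G \\ H`
exactly once. -/
def CoversComplement {G : Type*} [AddCommGroup G] (H : AddSubgroup G) {m : ℕ}
    (f : Fin m ⊕ Fin m → G) : Prop :=
  Function.Injective f ∧ Set.range f = {z : G | z ∉ H}

/-- The pairs `{x i, y i}` form a frame starter in `G \\ H`: the entries hit each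
element of `G \\ H` exactly once, and so do the differences `±(x i - y i)`. -/
def IsFrameStarter {G : Type*} [AddCommGroup G] (H : AddSubgroup G) {m : ℕ}
    (x y : Fin m → G) : Prop :=
  CoversComplement H (Sum.elim x y) ∧
    CoversComplement H (Sum.elim (fun i => x i - y i) (fun i => y i - x i))

/-- A frame starter is strong if the sums `x i + y i` avoid `H` and are pairwise
distinct. -/
def IsStrongFS {G : Type*} [AddCommGroup G] (H : AddSubgroup G) {m : ℕ}
    (x y : Fin m → G) : Prop :=
  (∀ i, x i + y i ∉ H) ∧ Function.Injective fun i => x i + y i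

/-- A frame starter is skew if the sums `±(x i + y i)` hit each element of
`G \\ H` exactly once. -/
def IsSkewFS {G : Type*} [AddCommGroup G] (H : AddSubgroup G) {m : ℕ}
    (x y : Fin m → G) : Prop :=
  CoversComplement H (Sum.elim (fun i => x i + y i) (fun i => -(x i + y i)))

/-- If `f` covers `G \ H` and `g` vanishes on `H`, then summing `g` along `f` is the same as
summing `g` over `G`. -/
theorem CoversComplement.sum_comp {G M : Type*} [AddCommGroup G] [Fintype G] [AddCommMonoid M]
    {H : AddSubgroup G} {m : ℕ} {f : Fin m ⊕ Fin m → G} (hf : CoversComplement H f)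
    (g : G → M) (hg : ∀ z ∈ H, g z = 0) : ∑ i, g (f i) = ∑ z, g z := by
  refine Fintype.sum_of_injective f hf.1 _ _ (fun z hz => hg z ?_) (fun _ => rfl)
  rw [hf.2] at hz
  simpa using hz

theorem ZMod.sum_univ_eq_sum_range {M : Type*} [AddCommMonoid M] (n : ℕ) [NeZero n]
    (g : ZMod n → M) : ∑ z, g z = ∑ i ∈ Finset.range n, g i := by
  symm
  refine Finset.sum_bij' (fun i _ => (i : ZMod n)) (fun z _ => z.val) ?_ ?_ ?_ ?_ ?_
  · simp
  · simp [ZMod.val_lt]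
  · intro i hi
    exact ZMod.val_cast_of_lt (Finset.mem_range.mp hi)
  · simp
  · simp

theorem six_mul_sum_range_succ_sq (n : ℕ) :
    6 * ∑ i ∈ Finset.range (n + 1), i ^ 2 = n * (n + 1) * (2 * n + 1) := by
  induction n with
  | zero => simp
  | succ n ih =>
    rw [Finset.sum_range_succ, mul_add, ih]
    ring

/-- In a skew frame starter, twice the sum of `c * z ^ 2` over the whole ring vanishes, provided
that `c * z ^ 2` vanishes on `H`. -/
theorem IsFrameStarter.two_mul_sum_sq_eq_zero {R : Type*} [CommRing R] [Fintype R]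
    {H : AddSubgroup R} {m : ℕ} {x y : Fin m → R} (h : IsFrameStarter H x y)
    (hskew : IsSkewFS H x y) (c : R) (hc : ∀ z ∈ H, c * z ^ 2 = 0) :
    2 * ∑ z : R, c * z ^ 2 = 0 := by
  have entries := h.1.sum_comp (fun z => c * z ^ 2) hc
  have differences := h.2.sum_comp (fun z => c * z ^ 2) hc
  have sums := CoversComplement.sum_comp hskew (fun z => c * z ^ 2) hc
  simp only [Fintype.sum_sum_type, Sum.elim_inl, Sum.elim_inr, ← Finset.sum_add_distrib]
    at entries differences sums
  have parallelogram : ∑ i, (c * (x i - y i) ^ 2 + c * (y i - x i) ^ 2) +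
      ∑ i, (c * (x i + y i) ^ 2 + c * (-(x i + y i)) ^ 2) =
      4 * ∑ i, (c * x i ^ 2 + c * y i ^ 2) := by
    rw [← Finset.sum_add_distrib, Finset.mul_sum]
    exact Finset.sum_congr rfl fun i _ => by ring
  rw [entries, differences, sums] at parallelogram
  linear_combination -parallelogram

/-- If `t ≡ 3 (mod 6)`, then there is no cyclic skew frame starter
of type `5^t` in `ℤ_{5t}` (with `H = {0, t, 2t, 3t, 4t}`). -/
theorem stmt11 (t : ℕ) (ht : 0 < t) (hmod : t % 6 = 3) :
    ¬ ∃ (m : ℕ) (x y : Fin m → ZMod (5 * t)),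
      IsFrameStarter (AddSubgroup.zmultiples (t : ZMod (5 * t))) x y ∧
        IsSkewFS (AddSubgroup.zmultiples (t : ZMod (5 * t))) x y := by
  rintro ⟨m, x, y, h, hskew⟩
  have : NeZero (5 * t) := ⟨by omega⟩
  have hH : ∀ z ∈ AddSubgroup.zmultiples (t : ZMod (5 * t)), 5 * z ^ 2 = 0 := by
    intro z hz
    obtain ⟨k, rfl⟩ := AddSubgroup.mem_zmultiples_iff.mp hz
    have h5 : (5 : ZMod (5 * t)) * t = 0 := by
      exact_mod_cast ZMod.natCast_self (5 * t)
    rw [zsmul_eq_mul]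
    linear_combination (k : ZMod (5 * t)) ^ 2 * t * h5
  have hzero := h.two_mul_sum_sq_eq_zero hskew 5 hH
  rw [ZMod.sum_univ_eq_sum_range, ← Finset.mul_sum] at hzero
  have hdvd : 5 * t ∣ 2 * (5 * ∑ i ∈ Finset.range (5 * t), i ^ 2) := by
    rw [← ZMod.natCast_eq_zero_iff]
    exact_mod_cast hzero
  obtain ⟨c, hc⟩ := hdvd
  obtain ⟨k, rfl⟩ : ∃ k, t = 6 * k + 3 := ⟨t / 6, by omega⟩
  have hsum := six_mul_sum_range_succ_sq (30 * k + 14)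
  rw [show 30 * k + 14 + 1 = 5 * (6 * k + 3) by ring] at hsum
  have hcancel : 3 * c = (30 * k + 14) * 5 * (60 * k + 29) := by
    refine Nat.eq_of_mul_eq_mul_left (show 0 < 5 * (6 * k + 3) by omega) ?_
    linear_combination 5 * hsum - 3 * hc
  have hmod3 := congrArg (· % 3) hcancel
  simp [Nat.mul_mod, Nat.add_mod] at hmod3
end

section
/- If t is an odd positive integer, then there does not exist a cyclic skew frame starter of type 2^{4t} in Z_{8t}. -/
/-- The square of a residue modulo `8`, represented by the integer `0`, `1` or `4`. -/
def sqRep (a : ZMod 8) : ℤ := if a = 0 ∨ a = 4 then 0 else if a = 2 ∨ a = 6 then 4 else 1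

lemma sqRep_neg (a : ZMod 8) : sqRep (-a) = sqRep a := by
  revert a; decide

lemma sqRep_four_mul (a : ZMod 8) : sqRep (4 * a) = 0 := by
  revert a; decide

lemma sqRep_parallelogram (a b : ZMod 8) :
    (8 : ℤ) ∣ sqRep (a + b) + sqRep (a - b) - 2 * (sqRep a + sqRep b) := by
  revert a b; decide

lemma sum_range_sqRep (t : ℕ) : ∑ k ∈ Finset.range (8 * t), sqRep k = 12 * t := by
  induction t with
  | zero => simp
  | succ t ih =>
    have h8 : (8 : ZMod 8) = 0 := by decide
    have hval : sqRep 0 + sqRep 1 + sqRep 2 + sqRep 3 + sqRep 4 + sqRep 5 + sqRep 6 + sqRep 7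
        = 12 := by decide
    rw [Nat.mul_succ, Finset.sum_range_add, ih]
    simp only [Finset.sum_range_succ, Finset.sum_range_zero]
    push_cast
    simp only [h8, zero_mul, zero_add]
    linarith

lemma sum_sqRep_castHom (t : ℕ) [NeZero (8 * t)] :
    ∑ z : ZMod (8 * t), sqRep (ZMod.castHom (Dvd.intro t rfl) (ZMod 8) z) = 12 * t := by
  rw [← sum_range_sqRep]
  refine Finset.sum_bij' (fun z _ => z.val) (fun k _ => (k : ZMod (8 * t)))
    (fun z _ => Finset.mem_range.mpr z.val_lt) (fun _ _ => Finset.mem_univ _)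
    (fun z _ => ZMod.natCast_zmod_val z)
    (fun k hk => ZMod.val_cast_of_lt (Finset.mem_range.mp hk)) (fun z _ => ?_)
  rw [← map_natCast (ZMod.castHom (Dvd.intro t rfl) (ZMod 8)), ZMod.natCast_zmod_val]

lemma CoversComplement.sum_eq {G : Type*} [AddCommGroup G] [Fintype G] {H : AddSubgroup G} {m : ℕ}
    {f : Fin m ⊕ Fin m → G} (hf : CoversComplement H f) (F : G → ℤ) (hF : ∀ z ∈ H, F z = 0) :
    ∑ i, F (f (.inl i)) + ∑ i, F (f (.inr i)) = ∑ z, F z := by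
  rw [← Fintype.sum_sum_type (fun j => F (f j))]
  refine Fintype.sum_of_injective f hf.1 _ _ (fun z hz => hF z ?_) (fun _ => rfl)
  rw [hf.2] at hz
  simpa using hz

/-- If `t` is odd, then there is no cyclic skew frame starter of
type `2^(4t)` in `ℤ_{8t}` (with `H = {0, 4t}`). -/
theorem stmt16 (t : ℕ) (ht : 0 < t) (hodd : Odd t) :
    ¬ ∃ (m : ℕ) (x y : Fin m → ZMod (8 * t)),
      IsFrameStarter (AddSubgroup.zmultiples ((4 * t : ℕ) : ZMod (8 * t))) x y ∧
        IsSkewFS (AddSubgroup.zmultiples ((4 * t : ℕ) : ZMod (8 * t))) x y := by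
  rintro ⟨m, x, y, ⟨hxy, hsub⟩, hadd⟩
  have : NeZero (8 * t) := ⟨by omega⟩
  let φ := ZMod.castHom (Dvd.intro t rfl : 8 ∣ 8 * t) (ZMod 8)
  have hzero : ∀ z ∈ AddSubgroup.zmultiples ((4 * t : ℕ) : ZMod (8 * t)), sqRep (φ z) = 0 := by
    intro z hz
    obtain ⟨k, rfl⟩ := AddSubgroup.mem_zmultiples_iff.mp hz
    rw [← sqRep_four_mul (t * k)]
    congr 1
    rw [map_zsmul, map_natCast, zsmul_eq_mul]
    push_cast
    ring
  have hentries := hxy.sum_eq (fun z => sqRep (φ z)) hzero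
  have hdiffs := hsub.sum_eq (fun z => sqRep (φ z)) hzero
  have hsums := hadd.sum_eq (fun z => sqRep (φ z)) hzero
  have hneg : ∀ i, sqRep (φ (y i) - φ (x i)) = sqRep (φ (x i) - φ (y i)) := fun i => by
    rw [← sqRep_neg, neg_sub]
  simp only [Sum.elim_inl, Sum.elim_inr, map_neg, sqRep_neg, map_add, map_sub, hneg,
    φ, sum_sqRep_castHom t] at hentries hdiffs hsums
  have hdvd := Finset.dvd_sum (s := Finset.univ)
    fun i _ => sqRep_parallelogram (φ (x i)) (φ (y i))
  simp only [Finset.sum_sub_distrib, Finset.sum_add_distrib, ← Finset.mul_sum, φ] at hdvd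
  obtain ⟨s, rfl⟩ := hodd
  omega
end
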